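/- Let n > 0, β > 0, u ∈ ℝ³ and let J(q) = J(n,β,u;q) be the Jüttner distribution. Then, for each i = 1,2,3: (a) ∫_{ℝ³} (qⁱ (q·u)/q⁰) J dq = uⁱ ( n/β + n(Ψ(β) + 1/β)|u|² ); (b) ∫_{ℝ³} J ln(J) dq = n √(1+|u|²) ( ln( n/M(β) ) − β Ψ(β) ); (c) ∫_{ℝ³} (qⁱ/q⁰) J ln(J) dq = n uⁱ ( ln( n/M(β) ) − β Ψ(β) ). -/

import Mathlib

open MeasureTheory Real
open scoped InnerProductSpace

noncomputable section

/-- Momentum space `ℝ³`. -/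
abbrev E3 := EuclideanSpace ℝ (Fin 3)

/-- `q⁰ = √(1+|q|²)`. -/
def q0 (q : E3) : ℝ := Real.sqrt (1 + ‖q‖ ^ 2)

/-- Modified Bessel function `K_j(β) = ∫₀^∞ cosh(j r) exp(−β cosh r) dr`. -/
def Kb (j : ℕ) (β : ℝ) : ℝ :=
  ∫ r in Set.Ioi (0 : ℝ), Real.cosh (j * r) * Real.exp (-β * Real.cosh r)

end

noncomputable section

/-- `M(β) = ∫_{ℝ³} exp(−β √(1+|p|²)) dp`. -/
def Mf (β : ℝ) : ℝ := ∫ p : E3, Real.exp (-β * Real.sqrt (1 + ‖p‖ ^ 2))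

/-- `Ψ(β) = 3/β + K₁(β)/K₂(β)`. -/
def Ψf (β : ℝ) : ℝ := 3 / β + Kb 1 β / Kb 2 β

/-- The dimensionless Jüttner distribution
`J(n,β,u;q) = (n/M(β)) exp(−β(√(1+|u|²) q⁰ − u·q))`. -/
def Jut (n β : ℝ) (u : E3) (q : E3) : ℝ :=
  n / Mf β * Real.exp (-β * (Real.sqrt (1 + ‖u‖ ^ 2) * q0 q - ⟪u, q⟫_ℝ))

end

section Integrability

variable {E : Type*} [NormedAddCommGroup E] [NormedSpace ℝ E] [FiniteDimensional ℝ E]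
  [MeasurableSpace E] [BorelSpace E]

/-- A continuous function of at most quadratic growth is integrable against
`exp (-β √(1 + ‖x‖²))` in dimension at most three. -/
lemma integrable_mul_exp_neg_sqrt {μ : Measure E} [μ.IsAddHaarMeasure]
    (hE : Module.finrank ℝ E ≤ 3) {β : ℝ} (hβ : 0 < β) {g : E → ℝ} (hg : Continuous g) (C : ℝ)
    (hC : ∀ x, |g x| ≤ C * (1 + ‖x‖ ^ 2)) :
    Integrable (fun x => g x * Real.exp (-β * √(1 + ‖x‖ ^ 2))) μ := by
  have hr : (Module.finrank ℝ E : ℝ) < 4 := by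
    have : (Module.finrank ℝ E : ℝ) ≤ 3 := by exact_mod_cast hE
    linarith
  have hI := (integrable_rpow_neg_one_add_norm_sq (μ := μ) hr).const_mul (C * (720 / β ^ 6))
  refine hI.mono' (by fun_prop) (Filter.Eventually.of_forall fun x => ?_)
  have hC0 : 0 ≤ C := by
    have h0 := (abs_nonneg _).trans (hC 0)
    simpa using h0
  have hs : 0 < 1 + ‖x‖ ^ 2 := by positivity
  have hexp := Real.pow_div_factorial_le_exp (β * √(1 + ‖x‖ ^ 2)) (by positivity) 6
  have h6 : √(1 + ‖x‖ ^ 2) ^ 6 = (1 + ‖x‖ ^ 2) ^ 3 := by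
    rw [show 6 = 2 * 3 from rfl, pow_mul, Real.sq_sqrt hs.le]
  have hf : ((6).factorial : ℝ) = 720 := by norm_num [Nat.factorial]
  rw [mul_pow, h6, hf] at hexp
  have hle : Real.exp (-β * √(1 + ‖x‖ ^ 2)) ≤ 720 / β ^ 6 * ((1 + ‖x‖ ^ 2) ^ 3)⁻¹ := by
    rw [neg_mul, Real.exp_neg]
    calc (Real.exp (β * √(1 + ‖x‖ ^ 2)))⁻¹ ≤ (β ^ 6 * (1 + ‖x‖ ^ 2) ^ 3 / 720)⁻¹ := by
          gcongr
      _ = _ := by field_simp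
  have hp : (1 + ‖x‖ ^ 2) ^ (-(4 : ℝ) / 2) = ((1 + ‖x‖ ^ 2) ^ 2)⁻¹ := by
    rw [show (-(4 : ℝ) / 2) = -((2 : ℕ) : ℝ) by norm_num, Real.rpow_neg hs.le, Real.rpow_natCast]
  rw [hp, norm_mul, Real.norm_eq_abs, Real.norm_eq_abs, abs_of_pos (Real.exp_pos _)]
  calc |g x| * Real.exp (-β * √(1 + ‖x‖ ^ 2))
      ≤ (C * (1 + ‖x‖ ^ 2)) * (720 / β ^ 6 * ((1 + ‖x‖ ^ 2) ^ 3)⁻¹) := by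
        gcongr
        exact hC x
    _ = _ := by field_simp

end Integrability

section HalfLine

/-- The substitution `r = sinh t` on the half line. -/
lemma integral_comp_sinh_mul_cosh (g : ℝ → ℝ) :
    ∫ r in Set.Ioi (0 : ℝ), g r = ∫ t in Set.Ioi (0 : ℝ), Real.cosh t * g (Real.sinh t) := by
  have himg : Real.sinh '' Set.Ioi 0 = Set.Ioi 0 := by
    ext y
    constructor
    · rintro ⟨t, ht, rfl⟩
      exact Real.sinh_pos_iff.2 ht
    · intro hy
      exact ⟨Real.arsinh y, Real.arsinh_pos_iff.2 hy, Real.sinh_arsinh y⟩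
  rw [← himg, integral_image_eq_integral_abs_deriv_smul measurableSet_Ioi
    (fun x _ => (Real.hasDerivAt_sinh x).hasDerivWithinAt) Real.sinh_injective.injOn, himg]
  simp [abs_of_pos (Real.cosh_pos _)]

lemma sqrt_one_add_sinh_sq (t : ℝ) : √(1 + Real.sinh t ^ 2) = Real.cosh t := by
  rw [← Real.cosh_sq', Real.sqrt_sq (Real.cosh_pos t).le]

lemma Kb_one_eq (β : ℝ) :
    Kb 1 β = ∫ r in Set.Ioi (0 : ℝ), Real.exp (-β * √(1 + r ^ 2)) := by
  rw [integral_comp_sinh_mul_cosh]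
  simp [Kb, sqrt_one_add_sinh_sq]

lemma Kb_two_eq (β : ℝ) :
    Kb 2 β = ∫ r in Set.Ioi (0 : ℝ),
      (1 + 2 * r ^ 2) / √(1 + r ^ 2) * Real.exp (-β * √(1 + r ^ 2)) := by
  rw [integral_comp_sinh_mul_cosh]
  refine integral_congr_ae (Filter.Eventually.of_forall fun t => ?_)
  have := (Real.cosh_pos t).ne'
  simp only [sqrt_one_add_sinh_sq, Nat.cast_ofNat]
  rw [Real.cosh_two_mul, Real.cosh_sq']
  field_simp
  ring

lemma integrable_real_mul_exp_neg_sqrt {β : ℝ} (hβ : 0 < β) {g : ℝ → ℝ} (hg : Continuous g)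
    (C : ℝ) (hC : ∀ x, |g x| ≤ C * (1 + x ^ 2)) :
    Integrable (fun x : ℝ => g x * Real.exp (-β * √(1 + x ^ 2))) := by
  simpa using integrable_mul_exp_neg_sqrt (μ := volume) (by simp) hβ hg C (by simpa using hC)

lemma hasDerivAt_sqrt_one_add_sq (r : ℝ) :
    HasDerivAt (fun r : ℝ => √(1 + r ^ 2)) (r / √(1 + r ^ 2)) r := by
  have h : HasDerivAt (fun r : ℝ => 1 + r ^ 2) (2 * r) r := by
    simpa using (hasDerivAt_pow 2 r).const_add 1
  convert h.sqrt (by positivity) using 1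
  field_simp

lemma hasDerivAt_exp_neg_sqrt_one_add_sq (β r : ℝ) :
    HasDerivAt (fun r : ℝ => Real.exp (-β * √(1 + r ^ 2)))
      (-β * (r / √(1 + r ^ 2)) * Real.exp (-β * √(1 + r ^ 2))) r := by
  convert ((hasDerivAt_sqrt_one_add_sq r).const_mul (-β)).exp using 1
  ring

lemma one_le_sqrt_one_add_sq (x : ℝ) : 1 ≤ √(1 + x ^ 2) :=
  Real.one_le_sqrt.2 (by nlinarith [sq_nonneg x])

lemma abs_le_sqrt_one_add_sq (x : ℝ) : |x| ≤ √(1 + x ^ 2) :=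
  Real.abs_le_sqrt (by linarith)

lemma integral_sq_div_sqrt_mul_exp {β : ℝ} (hβ : 0 < β) :
    β * ∫ r in Set.Ioi (0 : ℝ), r ^ 2 / √(1 + r ^ 2) * Real.exp (-β * √(1 + r ^ 2)) = Kb 1 β := by
  have hne : ∀ x : ℝ, √(1 + x ^ 2) ≠ 0 := fun x => (by positivity : 0 < √(1 + x ^ 2)).ne'
  have i0 : Integrable (fun x : ℝ => Real.exp (-β * √(1 + x ^ 2))) := by
    simpa using integrable_real_mul_exp_neg_sqrt hβ (continuous_const (y := (1 : ℝ))) 1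
      (fun x => by norm_num; positivity)
  have i1 := integrable_real_mul_exp_neg_sqrt hβ continuous_id 1 (fun x => by
    simp only [id]; nlinarith [sq_abs x, sq_nonneg (|x| - 1)])
  have i2 := integrable_real_mul_exp_neg_sqrt (g := fun x => x ^ 2 / √(1 + x ^ 2)) hβ
    (by fun_prop (disch := assumption)) 1 (fun x => by
      rw [abs_of_nonneg (by positivity)]
      refine (div_le_self (by positivity) (one_le_sqrt_one_add_sq x)).trans (by linarith))
  have hd : ∀ x : ℝ, HasDerivAt (fun x : ℝ => x * Real.exp (-β * √(1 + x ^ 2)))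
      (Real.exp (-β * √(1 + x ^ 2)) - β * (x ^ 2 / √(1 + x ^ 2) * Real.exp (-β * √(1 + x ^ 2))))
      x := fun x => by
    refine ((hasDerivAt_id' x).fun_mul (hasDerivAt_exp_neg_sqrt_one_add_sq β x)).congr_deriv ?_
    ring
  have i3 := i0.sub (i2.const_mul β)
  have ht := tendsto_zero_of_hasDerivAt_of_integrableOn_Ioi (a := 0) (fun x _ => hd x)
    i3.integrableOn i1.integrableOn
  have := integral_Ioi_of_hasDerivAt_of_tendsto' (a := 0) (fun x _ => hd x) i3.integrableOn ht
  rw [integral_sub i0.integrableOn (i2.const_mul β).integrableOn, integral_const_mul] at this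
  rw [Kb_one_eq]
  linarith

lemma integral_sq_mul_exp {β : ℝ} (hβ : 0 < β) :
    β * ∫ r in Set.Ioi (0 : ℝ), r ^ 2 * Real.exp (-β * √(1 + r ^ 2)) = Kb 2 β := by
  have hne : ∀ x : ℝ, √(1 + x ^ 2) ≠ 0 := fun x => (by positivity : 0 < √(1 + x ^ 2)).ne'
  have i0 := integrable_real_mul_exp_neg_sqrt (g := fun x => (1 + 2 * x ^ 2) / √(1 + x ^ 2)) hβ
    (by fun_prop (disch := assumption)) 2 (fun x => by
      rw [abs_of_nonneg (by positivity)]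
      refine (div_le_self (by positivity) (one_le_sqrt_one_add_sq x)).trans (by linarith))
  have i1 := integrable_real_mul_exp_neg_sqrt (g := fun x => x * √(1 + x ^ 2)) hβ
    (by fun_prop) 1 (fun x => by
      rw [abs_mul, abs_of_nonneg (Real.sqrt_nonneg _)]
      have := mul_le_mul_of_nonneg_right (abs_le_sqrt_one_add_sq x)
        (Real.sqrt_nonneg (1 + x ^ 2))
      rw [Real.mul_self_sqrt (by positivity)] at this
      linarith)
  have i2 := integrable_real_mul_exp_neg_sqrt (g := fun x => x ^ 2) hβ
    (by fun_prop) 1 (fun x => by rw [abs_of_nonneg (by positivity)]; linarith)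
  have hd : ∀ x : ℝ, HasDerivAt (fun x : ℝ => x * √(1 + x ^ 2) * Real.exp (-β * √(1 + x ^ 2)))
      ((1 + 2 * x ^ 2) / √(1 + x ^ 2) * Real.exp (-β * √(1 + x ^ 2))
        - β * (x ^ 2 * Real.exp (-β * √(1 + x ^ 2)))) x := fun x => by
    refine (((hasDerivAt_id' x).fun_mul (hasDerivAt_sqrt_one_add_sq x)).fun_mul
      (hasDerivAt_exp_neg_sqrt_one_add_sq β x)).congr_deriv ?_
    have := hne x
    have hs : √(1 + x ^ 2) ^ 2 = 1 + x ^ 2 := Real.sq_sqrt (by positivity)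
    field_simp
    rw [hs]
    ring
  have i3 := i0.sub (i2.const_mul β)
  have ht := tendsto_zero_of_hasDerivAt_of_integrableOn_Ioi (a := 0) (fun x _ => hd x)
    i3.integrableOn i1.integrableOn
  have := integral_Ioi_of_hasDerivAt_of_tendsto' (a := 0) (fun x _ => hd x) i3.integrableOn ht
  rw [integral_sub i0.integrableOn (i2.const_mul β).integrableOn, integral_const_mul] at this
  rw [Kb_two_eq]
  linarith

end HalfLine

section Moments

lemma q0_pos (q : E3) : 0 < q0 q := Real.sqrt_pos.2 (by positivity)

lemma q0_sq (q : E3) : q0 q ^ 2 = 1 + ‖q‖ ^ 2 := Real.sq_sqrt (by positivity)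

lemma one_le_q0 (q : E3) : 1 ≤ q0 q := one_le_sqrt_one_add_sq _

lemma norm_le_q0 (q : E3) : ‖q‖ ≤ q0 q := by
  simpa [q0] using abs_le_sqrt_one_add_sq ‖q‖

lemma q0_neg (q : E3) : q0 (-q) = q0 q := by simp [q0]

@[fun_prop]
lemma continuous_q0 : Continuous q0 := by
  unfold q0
  fun_prop

lemma integrable_mul_exp_q0 {β : ℝ} (hβ : 0 < β) {g : E3 → ℝ} (hg : Continuous g) (C : ℝ)
    (hC : ∀ q, |g q| ≤ C * q0 q ^ 2) :
    Integrable (fun q => g q * Real.exp (-β * q0 q)) :=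
  integrable_mul_exp_neg_sqrt (by simp) hβ hg C (by simpa only [q0_sq] using hC)

variable {β : ℝ}

lemma integrable_exp_q0 (hβ : 0 < β) : Integrable (fun q : E3 => Real.exp (-β * q0 q)) := by
  simpa using integrable_mul_exp_q0 hβ (continuous_const (y := (1 : ℝ))) 1
    (fun q => by rw [abs_one]; nlinarith [one_le_q0 q])

lemma integrable_q0_mul_exp (hβ : 0 < β) :
    Integrable (fun q : E3 => q0 q * Real.exp (-β * q0 q)) :=
  integrable_mul_exp_q0 hβ continuous_q0 1
    (fun q => by rw [abs_of_pos (q0_pos q)]; nlinarith [one_le_q0 q])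

lemma integrable_inv_q0_mul_exp (hβ : 0 < β) :
    Integrable (fun q : E3 => 1 / q0 q * Real.exp (-β * q0 q)) :=
  integrable_mul_exp_q0 hβ (by fun_prop (disch := exact fun q => (q0_pos q).ne')) 1 (fun q => by
    have := q0_pos q
    rw [abs_of_pos (by positivity)]
    exact (div_le_self zero_le_one (one_le_q0 q)).trans (by nlinarith [one_le_q0 q]))

lemma abs_inner_le_mul_q0 (q v : E3) : |⟪q, v⟫_ℝ| ≤ ‖v‖ * q0 q := by
  have := mul_le_mul_of_nonneg_right (norm_le_q0 q) (norm_nonneg v)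
  linarith [abs_real_inner_le_norm q v]

lemma integrable_inner_mul_exp (hβ : 0 < β) (v : E3) :
    Integrable (fun q : E3 => ⟪q, v⟫_ℝ * Real.exp (-β * q0 q)) :=
  integrable_mul_exp_q0 hβ (by fun_prop) ‖v‖ (fun q => by
    refine (abs_inner_le_mul_q0 q v).trans ?_
    gcongr
    nlinarith [one_le_q0 q])

lemma integrable_inner_div_q0_mul_exp (hβ : 0 < β) (v : E3) :
    Integrable (fun q : E3 => ⟪q, v⟫_ℝ / q0 q * Real.exp (-β * q0 q)) :=
  integrable_mul_exp_q0 hβ (by fun_prop (disch := exact fun q => (q0_pos q).ne')) ‖v‖ (fun q => by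
    have := q0_pos q
    rw [abs_div, abs_of_pos this, div_le_iff₀ this]
    refine (abs_inner_le_mul_q0 q v).trans ?_
    have h3 : q0 q ≤ q0 q ^ 2 * q0 q :=
      le_mul_of_one_le_left this.le (one_le_pow₀ (one_le_q0 q))
    nlinarith [mul_le_mul_of_nonneg_left h3 (norm_nonneg v)])

lemma integrable_inner_mul_inner_div_q0_mul_exp (hβ : 0 < β) (v w : E3) :
    Integrable (fun q : E3 => ⟪q, v⟫_ℝ * ⟪q, w⟫_ℝ / q0 q * Real.exp (-β * q0 q)) :=
  integrable_mul_exp_q0 hβ (by fun_prop (disch := exact fun q => (q0_pos q).ne')) (‖v‖ * ‖w‖)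
    (fun q => by
      have := q0_pos q
      rw [abs_div, abs_of_pos this, abs_mul]
      calc |⟪q, v⟫_ℝ| * |⟪q, w⟫_ℝ| / q0 q ≤ (‖v‖ * q0 q) * (‖w‖ * q0 q) / q0 q := by
            gcongr <;> exact abs_inner_le_mul_q0 q _
        _ ≤ (‖v‖ * q0 q) * (‖w‖ * q0 q) := div_le_self (by positivity) (one_le_q0 q)
        _ = _ := by ring)

lemma hasFDerivAt_q0 (q : E3) : HasFDerivAt q0 ((1 / q0 q) • innerSL ℝ q) q := by
  have h : HasFDerivAt (fun q : E3 => 1 + ‖q‖ ^ 2) (2 • innerSL ℝ q) q :=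
    (hasStrictFDerivAt_norm_sq q).hasFDerivAt.const_add 1
  have h2 := h.sqrt (by positivity)
  change HasFDerivAt q0 _ q at h2
  have he : (1 / (2 * √(1 + ‖q‖ ^ 2))) • 2 • innerSL ℝ q = (1 / q0 q) • innerSL ℝ q := by
    ext v
    have := (q0_pos q).ne'
    simp only [← q0.eq_1, smul_apply, innerSL_apply_apply, smul_eq_mul,
      nsmul_eq_mul, Nat.cast_ofNat]
    field_simp
  rwa [he] at h2

lemma integral_inner_mul_inner_div_q0_mul_exp (hβ : 0 < β) (v w : E3) :
    ∫ q : E3, ⟪q, v⟫_ℝ * ⟪q, w⟫_ℝ / q0 q * Real.exp (-β * q0 q) = ⟪v, w⟫_ℝ * (Mf β / β) := by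
  have hf : ∀ q : E3, HasFDerivAt (fun q : E3 => ⟪q, v⟫_ℝ) (innerSL ℝ v) q := fun q => by
    simpa [real_inner_comm] using (innerSL ℝ v).hasFDerivAt (x := q)
  have hg : ∀ q : E3, HasFDerivAt (fun q : E3 => Real.exp (-β * q0 q))
      (Real.exp (-β * q0 q) • ((-β) • ((1 / q0 q) • innerSL ℝ q))) q := fun q =>
    ((hasFDerivAt_q0 q).const_mul (-β)).exp
  have e1 : ∀ q : E3, fderiv ℝ (fun q : E3 => ⟪q, v⟫_ℝ) q w = ⟪v, w⟫_ℝ := fun q => by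
    rw [(hf q).fderiv]; simp
  have e2 : ∀ q : E3, ⟪q, v⟫_ℝ * fderiv ℝ (fun q : E3 => Real.exp (-β * q0 q)) q w
      = -β * (⟪q, v⟫_ℝ * ⟪q, w⟫_ℝ / q0 q * Real.exp (-β * q0 q)) := fun q => by
    rw [(hg q).fderiv]
    simp
    ring
  have := integral_mul_fderiv_eq_neg_fderiv_mul_of_integrable (μ := (volume : Measure E3))
    (f := fun q : E3 => ⟪q, v⟫_ℝ) (g := fun q : E3 => Real.exp (-β * q0 q)) (v := w)
    (by simpa only [e1] using (integrable_exp_q0 hβ).const_mul _)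
    (by simpa only [e2] using (integrable_inner_mul_inner_div_q0_mul_exp hβ v w).const_mul _)
    (integrable_inner_mul_exp hβ v)
    (fun q _ => (hf q).differentiableAt) (fun q _ => (hg q).differentiableAt)
  simp only [e1, e2, integral_const_mul] at this
  change _ = -(⟪v, w⟫_ℝ * Mf β) at this
  rw [← mul_div_assoc, eq_div_iff hβ.ne']
  linarith

lemma Mf_pos (hβ : 0 < β) : 0 < Mf β := by
  unfold Mf
  exact integral_exp_pos (integrable_exp_q0 hβ)

lemma integral_inv_q0_mul_exp (hβ : 0 < β) :
    ∫ q : E3, 1 / q0 q * Real.exp (-β * q0 q) = Mf β * (Kb 1 β / Kb 2 β) := by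
  have h1 := integral_fun_norm_addHaar (volume : Measure E3)
    (fun r => 1 / √(1 + r ^ 2) * Real.exp (-β * √(1 + r ^ 2)))
  have h2 := integral_fun_norm_addHaar (volume : Measure E3)
    (fun r => Real.exp (-β * √(1 + r ^ 2)))
  have h3 := integral_sq_div_sqrt_mul_exp hβ
  have h4 := integral_sq_mul_exp hβ
  have hM := Mf_pos hβ
  simp only [finrank_euclideanSpace, Fintype.card_fin, nsmul_eq_mul, smul_eq_mul,
    Nat.add_one_sub_one, ← mul_assoc, mul_one_div] at h1 h2
  change Mf β = _ at h2
  change ∫ q : E3, 1 / √(1 + ‖q‖ ^ 2) * Real.exp (-β * √(1 + ‖q‖ ^ 2)) = _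
  rw [h1]
  rw [h2] at hM ⊢
  rw [← h3, ← h4, mul_div_mul_left _ _ hβ.ne', mul_assoc, mul_assoc,
    mul_div_cancel₀ _ (right_ne_zero_of_mul hM.ne'), ← mul_assoc]

lemma integral_q0_mul_exp (hβ : 0 < β) :
    ∫ q : E3, q0 q * Real.exp (-β * q0 q) = Mf β * Ψf β := by
  have hsum : ∀ q : E3, q0 q * Real.exp (-β * q0 q) = 1 / q0 q * Real.exp (-β * q0 q)
      + ∑ i : Fin 3, ⟪q, EuclideanSpace.single i 1⟫_ℝ * ⟪q, EuclideanSpace.single i 1⟫_ℝ / q0 q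
        * Real.exp (-β * q0 q) := fun q => by
    have h := q0_sq q
    have := (q0_pos q).ne'
    rw [EuclideanSpace.norm_sq_eq] at h
    simp only [EuclideanSpace.inner_single_right, Fin.sum_univ_three, Real.norm_eq_abs, sq_abs]
      at h ⊢
    simp
    field_simp
    linear_combination h
  simp only [hsum]
  rw [integral_add (integrable_inv_q0_mul_exp hβ)
    (integrable_finsetSum _ fun i _ => integrable_inner_mul_inner_div_q0_mul_exp hβ _ _),
    integral_finsetSum _ fun i _ => integrable_inner_mul_inner_div_q0_mul_exp hβ _ _,
    integral_inv_q0_mul_exp hβ]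
  simp only [integral_inner_mul_inner_div_q0_mul_exp hβ]
  simp [Ψf]
  ring

end Moments

section Boost

/-- The spatial part of the Lorentz boost taking the four-velocity `(1, 0)` to `(√(1+|u|²), u)`. -/
noncomputable def boost (u q : E3) : E3 := q + (⟪q, u⟫_ℝ / (1 + q0 u) + q0 q) • u

lemma inner_boost (u q : E3) : ⟪boost u q, u⟫_ℝ = q0 u * ⟪q, u⟫_ℝ + ‖u‖ ^ 2 * q0 q := by
  have hu := q0_pos u
  have h : ‖u‖ ^ 2 = q0 u ^ 2 - 1 := by linarith [q0_sq u]
  rw [boost, inner_add_left, real_inner_smul_left, real_inner_self_eq_norm_sq, h]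
  field_simp
  ring

lemma q0_boost (u q : E3) : q0 (boost u q) = q0 u * q0 q + ⟪q, u⟫_ℝ := by
  have hu := q0_pos u
  have h : ‖u‖ ^ 2 = q0 u ^ 2 - 1 := by linarith [q0_sq u]
  have hq : ‖q‖ ^ 2 = q0 q ^ 2 - 1 := by linarith [q0_sq q]
  have hnn : 0 ≤ q0 u * q0 q + ⟪q, u⟫_ℝ := by
    have h1 := neg_le_of_abs_le (abs_inner_le_mul_q0 q u)
    have h2 := mul_le_mul_of_nonneg_right (norm_le_q0 u) (q0_pos q).le
    linarith
  rw [q0, Real.sqrt_eq_iff_mul_self_eq (by positivity) hnn, boost, norm_add_sq_real, norm_smul,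
    mul_pow, Real.norm_eq_abs, sq_abs, real_inner_smul_right, h, hq]
  field_simp
  ring

lemma boost_neg_boost (u q : E3) : boost (-u) (boost u q) = q := by
  have hu := q0_pos u
  have h : ‖u‖ ^ 2 = q0 u ^ 2 - 1 := by linarith [q0_sq u]
  have hc : ⟪q, u⟫_ℝ / (1 + q0 u) + q0 q
      - (-(q0 u * ⟪q, u⟫_ℝ + (q0 u ^ 2 - 1) * q0 q) / (1 + q0 u) + (q0 u * q0 q + ⟪q, u⟫_ℝ))
      = 0 := by
    field_simp
    ring
  rw [boost, inner_neg_right, inner_boost, q0_neg, q0_boost, boost, smul_neg, ← sub_eq_add_neg,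
    add_sub_assoc, ← sub_smul, h, hc, zero_smul, add_zero]

lemma boost_bijective (u : E3) : Function.Bijective (boost u) :=
  Function.bijective_iff_has_inverse.2 ⟨boost (-u), boost_neg_boost u, fun q => by
    simpa using boost_neg_boost (-u) q⟩

/-- The derivative of `boost u` at `q`. -/
noncomputable def boostDeriv (u q : E3) : E3 →L[ℝ] E3 :=
  ContinuousLinearMap.id ℝ E3 +
    ((1 / (1 + q0 u)) • innerSL ℝ u + (1 / q0 q) • innerSL ℝ q).smulRight u

lemma hasFDerivAt_boost (u q : E3) : HasFDerivAt (boost u) (boostDeriv u q) q := by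
  have h1 : HasFDerivAt (fun q : E3 => ⟪q, u⟫_ℝ / (1 + q0 u)) ((1 / (1 + q0 u)) • innerSL ℝ u)
      q := by
    have := ((innerSL ℝ u).hasFDerivAt (x := q)).const_mul (1 / (1 + q0 u))
    simpa [real_inner_comm, div_eq_inv_mul] using this
  exact (hasFDerivAt_id q).add ((h1.add (hasFDerivAt_q0 q)).smul_const u)

lemma det_boostDeriv (u q : E3) : (boostDeriv u q).det = q0 (boost u q) / q0 q := by
  have h : (boostDeriv u q : E3 →ₗ[ℝ] E3) = LinearMap.transvection
      (((1 / (1 + q0 u)) • innerSL ℝ u + (1 / q0 q) • innerSL ℝ q : E3 →L[ℝ] ℝ) : E3 →ₗ[ℝ] ℝ)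
      u := by
    ext v
    simp [boostDeriv, LinearMap.transvection.apply]
  rw [ContinuousLinearMap.det, h, LinearMap.transvection.det, q0_boost]
  have hu := q0_pos u
  have hq := (q0_pos q).ne'
  have h : ‖u‖ ^ 2 = q0 u ^ 2 - 1 := by linarith [q0_sq u]
  simp [h]
  field_simp
  ring

/-- Lorentz invariance of the measure `dq / q⁰`. -/
lemma integral_comp_boost (u : E3) (F : E3 → ℝ) :
    ∫ q, F q = ∫ q, q0 (boost u q) / q0 q * F (boost u q) := by
  have h := integral_image_eq_integral_abs_det_fderiv_smul volume MeasurableSet.univ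
    (fun q _ => (hasFDerivAt_boost u q).hasFDerivWithinAt) (boost_bijective u).injective.injOn F
  rw [Set.image_univ, (boost_bijective u).surjective.range_eq] at h
  simp only [Measure.restrict_univ, det_boostDeriv, smul_eq_mul] at h
  rw [h]
  congr! 3 with q
  exact abs_of_pos (div_pos (q0_pos _) (q0_pos _))

lemma Jut_boost (n β : ℝ) (u q : E3) :
    Jut n β u (boost u q) = n / Mf β * Real.exp (-β * q0 q) := by
  have h : ‖u‖ ^ 2 = q0 u ^ 2 - 1 := by linarith [q0_sq u]
  rw [Jut, ← q0, real_inner_comm, inner_boost, q0_boost, h]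
  ring_nf

end Boost

section Main

lemma integral_eq_zero_of_odd {f : E3 → ℝ} (hf : ∀ q, f (-q) = -f q) : ∫ q, f q = 0 := by
  have h := integral_neg_eq_self f volume
  simp only [hf, integral_neg] at h
  linarith

lemma integral_inner_mul_exp (β : ℝ) (v : E3) :
    ∫ q : E3, ⟪q, v⟫_ℝ * Real.exp (-β * q0 q) = 0 :=
  integral_eq_zero_of_odd fun q => by simp [q0_neg]

lemma integral_inner_div_q0_mul_exp (β : ℝ) (v : E3) :
    ∫ q : E3, ⟪q, v⟫_ℝ / q0 q * Real.exp (-β * q0 q) = 0 :=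
  integral_eq_zero_of_odd fun q => by simp [q0_neg, neg_div]

variable {n β : ℝ}

lemma log_Jut_boost (hn : 0 < n) (hβ : 0 < β) (u q : E3) :
    Real.log (Jut n β u (boost u q)) = Real.log (n / Mf β) - β * q0 q := by
  rw [Jut_boost, Real.log_mul (div_pos hn (Mf_pos hβ)).ne' (Real.exp_pos _).ne', Real.log_exp]
  ring

/-- The momentum flux of a Jüttner distribution, contracted with `v` and with the velocity. -/
lemma integral_inner_mul_inner_div_q0_mul_Jut (hβ : 0 < β) (u v : E3) :
    ∫ q : E3, ⟪q, v⟫_ℝ * ⟪q, u⟫_ℝ / q0 q * Jut n β u q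
      = ⟪u, v⟫_ℝ * (n / β + n * (Ψf β + 1 / β) * ‖u‖ ^ 2) := by
  have hM := Mf_pos hβ
  have hu := q0_pos u
  have h : ‖u‖ ^ 2 = q0 u ^ 2 - 1 := by linarith [q0_sq u]
  have i1 := (integrable_inner_mul_inner_div_q0_mul_exp hβ v u).const_mul (n / Mf β * q0 u)
  have i2 := (integrable_inner_mul_inner_div_q0_mul_exp hβ u u).const_mul
    (n / Mf β * (⟪u, v⟫_ℝ * q0 u / (1 + q0 u)))
  have i3 := (integrable_q0_mul_exp hβ).const_mul (n / Mf β * (⟪u, v⟫_ℝ * ‖u‖ ^ 2))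
  have i4 := (integrable_inner_mul_exp hβ v).const_mul (n / Mf β * ‖u‖ ^ 2)
  have i5 := (integrable_inner_mul_exp hβ u).const_mul
    (n / Mf β * (⟪u, v⟫_ℝ * (‖u‖ ^ 2 / (1 + q0 u) + q0 u)))
  have hint : ∀ q : E3, q0 (boost u q) / q0 q *
      (⟪boost u q, v⟫_ℝ * ⟪boost u q, u⟫_ℝ / q0 (boost u q) * Jut n β u (boost u q))
      = n / Mf β * q0 u * (⟪q, v⟫_ℝ * ⟪q, u⟫_ℝ / q0 q * Real.exp (-β * q0 q))
        + n / Mf β * (⟪u, v⟫_ℝ * q0 u / (1 + q0 u)) *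
          (⟪q, u⟫_ℝ * ⟪q, u⟫_ℝ / q0 q * Real.exp (-β * q0 q))
        + n / Mf β * (⟪u, v⟫_ℝ * ‖u‖ ^ 2) * (q0 q * Real.exp (-β * q0 q))
        + n / Mf β * ‖u‖ ^ 2 * (⟪q, v⟫_ℝ * Real.exp (-β * q0 q))
        + n / Mf β * (⟪u, v⟫_ℝ * (‖u‖ ^ 2 / (1 + q0 u) + q0 u)) *
          (⟪q, u⟫_ℝ * Real.exp (-β * q0 q)) := fun q => by
    have hq := q0_pos q
    have hb := (q0_pos (boost u q)).ne'
    have hv : ⟪boost u q, v⟫_ℝ = ⟪q, v⟫_ℝ + (⟪q, u⟫_ℝ / (1 + q0 u) + q0 q) * ⟪u, v⟫_ℝ := by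
      rw [boost, inner_add_left, real_inner_smul_left]
    rw [Jut_boost, inner_boost, hv]
    field_simp
    ring
  rw [integral_comp_boost u]
  simp only [hint]
  rw [integral_add (((i1.fun_add i2).fun_add i3).fun_add i4) i5,
    integral_add ((i1.fun_add i2).fun_add i3) i4, integral_add (i1.fun_add i2) i3,
    integral_add i1 i2]
  simp only [integral_const_mul, integral_inner_mul_inner_div_q0_mul_exp hβ,
    integral_q0_mul_exp hβ, integral_inner_mul_exp]
  rw [real_inner_self_eq_norm_sq, real_inner_comm, h]
  field_simp
  ring

lemma integral_Jut_mul_log_Jut (hn : 0 < n) (hβ : 0 < β) (u : E3) :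
    ∫ q : E3, Jut n β u q * Real.log (Jut n β u q)
      = n * q0 u * (Real.log (n / Mf β) - β * Ψf β) := by
  have hM := Mf_pos hβ
  set L := Real.log (n / Mf β) with hL
  have i1 := (integrable_exp_q0 hβ).const_mul (n / Mf β * (q0 u * L))
  have i2 := (integrable_q0_mul_exp hβ).const_mul (n / Mf β * (q0 u * -β))
  have i3 := (integrable_inner_div_q0_mul_exp hβ u).const_mul (n / Mf β * L)
  have i4 := (integrable_inner_mul_exp hβ u).const_mul (n / Mf β * -β)
  have hint : ∀ q : E3, q0 (boost u q) / q0 q *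
      (Jut n β u (boost u q) * Real.log (Jut n β u (boost u q)))
      = n / Mf β * (q0 u * L) * Real.exp (-β * q0 q)
        + n / Mf β * (q0 u * -β) * (q0 q * Real.exp (-β * q0 q))
        + n / Mf β * L * (⟪q, u⟫_ℝ / q0 q * Real.exp (-β * q0 q))
        + n / Mf β * -β * (⟪q, u⟫_ℝ * Real.exp (-β * q0 q)) := fun q => by
    have hq := q0_pos q
    rw [log_Jut_boost hn hβ, Jut_boost, q0_boost, ← hL]
    field_simp
    ring
  have hMf : ∫ q : E3, Real.exp (-β * q0 q) = Mf β := rfl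
  rw [integral_comp_boost u]
  simp only [hint]
  rw [integral_add ((i1.fun_add i2).fun_add i3) i4, integral_add (i1.fun_add i2) i3,
    integral_add i1 i2]
  simp only [integral_const_mul, integral_inner_div_q0_mul_exp, hMf,
    integral_q0_mul_exp hβ, integral_inner_mul_exp]
  field_simp
  ring

lemma integral_inner_div_q0_mul_Jut_mul_log_Jut (hn : 0 < n) (hβ : 0 < β) (u v : E3) :
    ∫ q : E3, ⟪q, v⟫_ℝ / q0 q * (Jut n β u q * Real.log (Jut n β u q))
      = n * ⟪u, v⟫_ℝ * (Real.log (n / Mf β) - β * Ψf β) := by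
  have hM := Mf_pos hβ
  have hu := q0_pos u
  set L := Real.log (n / Mf β) with hL
  have i1 := (integrable_exp_q0 hβ).const_mul (n / Mf β * (⟪u, v⟫_ℝ * L))
  have i2 := (integrable_q0_mul_exp hβ).const_mul (n / Mf β * (⟪u, v⟫_ℝ * -β))
  have i3 := (integrable_inner_div_q0_mul_exp hβ (v + (⟪u, v⟫_ℝ / (1 + q0 u)) • u)).const_mul
    (n / Mf β * L)
  have i4 := (integrable_inner_mul_exp hβ (v + (⟪u, v⟫_ℝ / (1 + q0 u)) • u)).const_mul
    (n / Mf β * -β)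
  have hint : ∀ q : E3, q0 (boost u q) / q0 q * (⟪boost u q, v⟫_ℝ / q0 (boost u q) *
      (Jut n β u (boost u q) * Real.log (Jut n β u (boost u q))))
      = n / Mf β * (⟪u, v⟫_ℝ * L) * Real.exp (-β * q0 q)
        + n / Mf β * (⟪u, v⟫_ℝ * -β) * (q0 q * Real.exp (-β * q0 q))
        + n / Mf β * L * (⟪q, v + (⟪u, v⟫_ℝ / (1 + q0 u)) • u⟫_ℝ / q0 q * Real.exp (-β * q0 q))
        + n / Mf β * -β * (⟪q, v + (⟪u, v⟫_ℝ / (1 + q0 u)) • u⟫_ℝ * Real.exp (-β * q0 q)) :=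
      fun q => by
    have hq := q0_pos q
    have hb := (q0_pos (boost u q)).ne'
    have hv : ⟪boost u q, v⟫_ℝ = ⟪q, v⟫_ℝ + (⟪q, u⟫_ℝ / (1 + q0 u) + q0 q) * ⟪u, v⟫_ℝ := by
      rw [boost, inner_add_left, real_inner_smul_left]
    rw [log_Jut_boost hn hβ, Jut_boost, hv, inner_add_right, real_inner_smul_right, ← hL]
    field_simp
    ring
  have hMf : ∫ q : E3, Real.exp (-β * q0 q) = Mf β := rfl
  rw [integral_comp_boost u]
  simp only [hint]
  rw [integral_add ((i1.fun_add i2).fun_add i3) i4, integral_add (i1.fun_add i2) i3,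
    integral_add i1 i2]
  simp only [integral_const_mul, integral_inner_div_q0_mul_exp, hMf,
    integral_q0_mul_exp hβ, integral_inner_mul_exp]
  field_simp
  ring

end Main

/-- entropy fluxes of a Jüttner distribution `J(n,β,u;·)`. -/
theorem juttner_entropy_fluxes (n β : ℝ) (u : E3) (hn : 0 < n) (hβ : 0 < β) :
    (∀ i : Fin 3, (∫ q : E3, q i * ⟪q, u⟫_ℝ / q0 q * Jut n β u q)
        = u i * (n / β + n * (Ψf β + 1 / β) * ‖u‖ ^ 2)) ∧
    (∫ q : E3, Jut n β u q * Real.log (Jut n β u q))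
        = n * Real.sqrt (1 + ‖u‖ ^ 2) * (Real.log (n / Mf β) - β * Ψf β) ∧
    (∀ i : Fin 3, (∫ q : E3, q i / q0 q * (Jut n β u q * Real.log (Jut n β u q)))
        = n * u i * (Real.log (n / Mf β) - β * Ψf β)) := by
  refine ⟨fun i => ?_, integral_Jut_mul_log_Jut hn hβ u, fun i => ?_⟩
  · simpa [EuclideanSpace.inner_single_right] using
      integral_inner_mul_inner_div_q0_mul_Jut (n := n) hβ u (EuclideanSpace.single i 1)
  · simpa [EuclideanSpace.inner_single_right] using
      integral_inner_div_q0_mul_Jut_mul_log_Jut hn hβ u (EuclideanSpace.single i 1)
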